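/- Let s_1, ..., s_n be homogeneous polynomials in n variables over C such that the only common zero of s_1, ..., s_n is the origin. Then the polynomial ring C[x_1,...,x_n] is a free module over the subring C[s_1,...,s_n], of finite rank. -/

import Mathlib

open RingTheory.Sequence Pointwise

theorem X_weaklyRegular (n : ℕ) (K : Type*) [Field K] :
    IsWeaklyRegular (MvPolynomial (Fin n) K)
      (List.ofFn (fun i : Fin n => (MvPolynomial.X i : MvPolynomial (Fin n) K))) := by
  rw [isWeaklyRegular_iff]
  intro i hi
  have hi' : i < n := by simpa using hi
  have key : Ideal.ofList (List.take i (List.ofFn (fun i : Fin n =>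
      (MvPolynomial.X i : MvPolynomial (Fin n) K)))) =
      Ideal.span (MvPolynomial.X '' {j : Fin n | (j : ℕ) < i}) := by
    unfold Ideal.ofList
    congr 1
    ext x
    simp only [Set.mem_ofPred_eq, Set.mem_image, List.mem_take_iff_getElem]
    constructor
    · rintro ⟨j, hj, rfl⟩
      simp at hj
      exact ⟨⟨j, by omega⟩, by simp; omega, by simp⟩
    · rintro ⟨j, hj, rfl⟩
      exact ⟨j, by simp; omega, by simp⟩
  rw [key, smul_eq_mul, Ideal.mul_top, isSMulRegular_quotient_iff_mem_of_smul_mem]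
  intro x hx
  rw [MvPolynomial.mem_ideal_span_X_image] at hx ⊢
  intro m hm
  simp only [List.getElem_ofFn, smul_eq_mul] at hx
  obtain ⟨j, hj, hj'⟩ := hx (Finsupp.single ⟨i, hi'⟩ 1 + m) (by
    rw [MvPolynomial.mem_support_iff] at hm ⊢
    rwa [mul_comm, add_comm, MvPolynomial.coeff_mul_X])
  refine ⟨j, hj, ?_⟩
  have : j ≠ ⟨i, hi'⟩ := by
    rintro rfl
    simp at hj
  simpa [Finsupp.single_apply, this.symm] using hj'

theorem indep_of_weaklyRegular {K R : Type*} [Field K] [CommRing R] [Algebra K R]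
    {ι : Type*} [Fintype ι] (k : ℕ) :
    ∀ (M : Type*) [AddCommGroup M] [Module R M] (f : Fin k → R),
      IsWeaklyRegular M (List.ofFn f) → ∀ b : ι → M,
      (∀ c : ι → K, ∑ j, algebraMap K R (c j) • b j ∈
        (Ideal.ofList (List.ofFn f) • ⊤ : Submodule R M) → c = 0) →
      ∀ p : ι → MvPolynomial (Fin k) K, ∑ j, MvPolynomial.aeval f (p j) • b j = 0 → p = 0 := by
  induction k with
  | zero =>
    intro M _ _ f _ b hb p hp
    have : ∀ j, p j = MvPolynomial.C (MvPolynomial.coeff 0 (p j)) := fun j =>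
      MvPolynomial.eq_C_of_isEmpty (p j)
    have h0 := hb (fun j => MvPolynomial.coeff 0 (p j)) (by
      have : ∑ j, algebraMap K R (MvPolynomial.coeff 0 (p j)) • b j = 0 := by
        rw [← hp]
        refine Finset.sum_congr rfl fun j _ => ?_
        conv_rhs => rw [this j]
        rw [MvPolynomial.aeval_C]
      rw [this]
      exact zero_mem _)
    funext j
    rw [this j, congrFun h0 j]
    simp
  | succ k ih =>
    intro M _ _ f hf b hb p hp
    rw [List.ofFn_succ, isWeaklyRegular_cons_iff] at hf
    obtain ⟨h0, hf⟩ := hf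
    rw [List.ofFn_succ] at hb
    set g : Fin k → R := fun i => f i.succ with hg
    let φ : MvPolynomial (Fin k) K →+* R := (MvPolynomial.aeval g : _ →ₐ[K] R).toRingHom
    have hev : ∀ q : MvPolynomial (Fin (k+1)) K, MvPolynomial.aeval f q =
        Polynomial.eval₂ φ (f 0) (MvPolynomial.finSuccEquiv K k q) := by
      intro q
      induction q using MvPolynomial.induction_on with
      | C a => simp [φ, MvPolynomial.finSuccEquiv_apply]
      | add p q hp hq => simp [hp, hq, Polynomial.eval₂_add]
      | mul_X p i hp =>
        rw [map_mul, map_mul, Polynomial.eval₂_mul, hp]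
        congr 1
        refine Fin.cases ?_ (fun i => ?_) i
        · rw [MvPolynomial.finSuccEquiv_X_zero]
          simp
        · rw [MvPolynomial.finSuccEquiv_X_succ]
          simp [φ, hg]
    have hb' : ∀ c : ι → K, ∑ j, algebraMap K R (c j) • Submodule.mkQ (f 0 • ⊤ : Submodule R M) (b j) ∈
        (Ideal.ofList (List.ofFn g) • ⊤ : Submodule R (QuotSMulTop (f 0) M)) → c = 0 := by
      intro c hc
      apply hb c
      rw [Ideal.ofList_cons_smul]
      have h1 : (Ideal.ofList (List.ofFn g) • ⊤ : Submodule R (QuotSMulTop (f 0) M)) =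
        Submodule.map (Submodule.mkQ (f 0 • ⊤ : Submodule R M))
          (Ideal.ofList (List.ofFn g) • ⊤ : Submodule R M) := by
        rw [Submodule.map_smul'', Submodule.map_top, Submodule.range_mkQ]
      simp only [← map_smul, ← map_sum] at hc
      rw [h1, ← Submodule.mem_comap, Submodule.comap_map_eq, Submodule.ker_mkQ, sup_comm] at hc
      exact hc
    have main : ∀ N : ℕ, ∀ P : ι → Polynomial (MvPolynomial (Fin k) K),
        (∀ j, (P j).degree < N) → ∑ j, Polynomial.eval₂ φ (f 0) (P j) • b j = 0 → P = 0 := by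
      intro N
      induction N with
      | zero =>
        intro P hP _
        funext j
        simpa using hP j
      | succ N ihN =>
        intro P hP hs
        have hdec : ∀ j, Polynomial.eval₂ φ (f 0) (P j) =
            f 0 * Polynomial.eval₂ φ (f 0) (P j).divX + φ ((P j).coeff 0) := by
          intro j
          conv_lhs => rw [← Polynomial.X_mul_divX_add (P j)]
          rw [Polynomial.eval₂_add, Polynomial.eval₂_mul, Polynomial.eval₂_X, Polynomial.eval₂_C]
        have hc0 : (fun j => (P j).coeff 0) = 0 := by
          refine ih (QuotSMulTop (f 0) M) g hf _ hb' _ ?_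
          have := congrArg (Submodule.mkQ (f 0 • ⊤ : Submodule R M)) hs
          rw [map_sum, map_zero] at this
          rw [← this]
          refine Finset.sum_congr rfl fun j _ => ?_
          rw [hdec, add_smul, map_add, mul_smul, ← map_smul]
          have : (f 0 • ⊤ : Submodule R M).mkQ (f 0 • Polynomial.eval₂ φ (f 0) (P j).divX • b j) = 0 := by
            rw [← LinearMap.mem_ker, Submodule.ker_mkQ]
            exact Submodule.smul_mem_pointwise_smul _ _ _ trivial
          rw [this, zero_add]
          rfl
        have hd : (fun j => (P j).divX) = 0 := by
          apply ihN
          · intro j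
            by_cases h : P j = 0
            · simp [h]
            · have h1 := hP j
              have h2 := Polynomial.degree_divX_lt h
              rw [Polynomial.degree_lt_iff_coeff_zero] at h1 ⊢
              intro m hm
              rw [Polynomial.coeff_divX]
              exact h1 _ (by omega)
          · apply h0.right_eq_zero_of_smul
            rw [Finset.smul_sum, ← hs]
            refine Finset.sum_congr rfl fun j _ => ?_
            rw [hdec, congrFun hc0 j, ← mul_smul]
            simp
        funext j
        rw [← Polynomial.X_mul_divX_add (P j), congrFun hc0 j, congrFun hd j]
        simp
    have hP := main ((Finset.univ.sup fun j => (MvPolynomial.finSuccEquiv K k (p j)).natDegree) + 1)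
      (fun j => MvPolynomial.finSuccEquiv K k (p j)) (fun j => by
        refine lt_of_le_of_lt Polynomial.degree_le_natDegree ?_
        exact_mod_cast Nat.lt_succ_of_le (Finset.le_sup (f := fun j => (MvPolynomial.finSuccEquiv K k (p j)).natDegree) (Finset.mem_univ j)))
      (by simpa only [hev] using hp)
    funext j
    have := congrFun hP j
    simpa using this

theorem exists_mem_isSMulRegular {K R : Type*} [Field K] [Infinite K] [CommRing R] [Algebra K R]
    [IsNoetherianRing R] (D : Type*) [AddCommGroup D] [Module R D] [Module.Finite R D]
    (V : Submodule K R) (h : ∀ x : D, (∀ v ∈ V, v • x = 0) → x = 0) :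
    ∃ v ∈ V, IsSMulRegular D v := by
  by_contra! hcon
  have : Finite (associatedPrimes R D) := associatedPrimes.finite R D
  let p : associatedPrimes R D → Submodule K V := fun P =>
    (Submodule.restrictScalars K P.1).comap V.subtype
  obtain ⟨P, hP⟩ := Subspace.exists_eq_top_of_iUnion_eq_univ (p := p) (by
    rw [Set.eq_univ_iff_forall]
    rintro ⟨v, hv⟩
    have h1 : v ∈ ⋃ p ∈ associatedPrimes R D, (p : Set R) := by
      rw [biUnion_associatedPrimes_eq_zero_divisors]
      have := hcon v hv
      rw [isSMulRegular_iff_right_eq_zero_of_smul] at this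
      push Not at this
      obtain ⟨x, hx, hx'⟩ := this
      exact ⟨x, hx', hx⟩
    simp only [Set.mem_iUnion] at h1 ⊢
    obtain ⟨P, hP, hv'⟩ := h1
    exact ⟨⟨P, hP⟩, hv'⟩)
  have hVP : ∀ v ∈ V, v ∈ P.1 := by
    intro v hv
    have : (⟨v, hv⟩ : V) ∈ p P := by rw [hP]; trivial
    exact this
  have hPP := P.2
  rw [AssociatedPrimes.mem_iff, isAssociatedPrime_iff] at hPP
  obtain ⟨hprime, x, hx⟩ := hPP
  have hx0 : x = 0 := by
    apply h
    intro v hv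
    have := hVP v hv
    rw [hx] at this
    simpa [Submodule.mem_colon_singleton] using this
  apply hprime.ne_top
  rw [hx, hx0, Ideal.eq_top_iff_one]
  simp [Submodule.mem_colon_singleton]

open IsLocalRing in
theorem exists_weaklyRegular_list {K R : Type*} [Field K] [Infinite K] [CommRing R] [Algebra K R]
    [IsNoetherianRing R] [IsLocalRing R] (n : ℕ) :
    ∀ (M : Type*) [AddCommGroup M] [Module R M] [Module.Finite R M] [Nontrivial M]
      (θ : List R), θ.length = n → (∀ r ∈ θ, r ∈ maximalIdeal R) → IsWeaklyRegular M θ →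
    ∀ V : Submodule K R, FiniteDimensional K V → Module.finrank K V ≤ n →
      (∀ v ∈ V, v ∈ maximalIdeal R) →
      (∀ r ∈ maximalIdeal R, ∃ N : ℕ, r ^ N ∈ Ideal.span (V : Set R) ⊔ Module.annihilator R M) →
      ∃ η : List R, IsWeaklyRegular M η ∧ Submodule.span K {x | x ∈ η} = V := by
  induction n with
  | zero =>
    intro M _ _ _ _ θ _ _ _ V _ hfr _ _
    refine ⟨[], IsWeaklyRegular.nil R M, ?_⟩
    have : V = ⊥ := Submodule.finrank_eq_zero.mp (by omega)
    simp [this]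
  | succ n ih =>
    intro M _ _ _ _ θ hlen hθm hθ V _ hfr hVm hV
    obtain ⟨θ', t, rfl⟩ : ∃ θ' t, θ = θ' ++ [t] := by
      have : θ ≠ [] := by rintro rfl; simp at hlen
      exact ⟨_, _, (List.dropLast_append_getLast this).symm⟩
    have hlen' : θ'.length = n := by simpa using hlen
    have hθ'm : ∀ r ∈ θ', r ∈ maximalIdeal R := fun r hr => hθm r (by simp [hr])
    have htm : t ∈ maximalIdeal R := hθm t (by simp)
    rw [isWeaklyRegular_append_iff, isWeaklyRegular_singleton_iff] at hθ
    obtain ⟨hθ', ht⟩ := hθ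
    have hreg : IsRegular M θ' := IsRegular.of_isWeaklyRegular_of_mem_maximalIdeal M hθ'm hθ'
    have hDnt : Nontrivial (M ⧸ (Ideal.ofList θ' • ⊤ : Submodule R M)) :=
      hreg.quot_ofList_smul_nontrivial ⊤
    obtain ⟨v, hv, hvreg⟩ := exists_mem_isSMulRegular
      (M ⧸ (Ideal.ofList θ' • ⊤ : Submodule R M)) V (by
        intro x hx
        obtain ⟨N, hN⟩ := hV t htm
        have hle : Ideal.span (V : Set R) ⊔ Module.annihilator R M ≤
            Module.annihilator R (Submodule.span R {x}) := by
          refine sup_le (Ideal.span_le.mpr fun v hv => ?_) fun r hr => ?_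
          · rw [SetLike.mem_coe, ← Submodule.annihilator, Submodule.mem_annihilator_span_singleton]
            exact hx v hv
          · rw [← Submodule.annihilator, Submodule.mem_annihilator_span_singleton]
            obtain ⟨y, rfl⟩ := Submodule.mkQ_surjective _ x
            rw [← map_smul, Module.mem_annihilator.mp hr, map_zero]
        have h2 := hle hN
        rw [← Submodule.annihilator, Submodule.mem_annihilator_span_singleton] at h2
        exact (ht.pow N).right_eq_zero_of_smul h2)
    have hperm : IsWeaklyRegular M (v :: θ') := by
      refine isWeaklyRegular_of_perm_of_subset_maximalIdeal (rs := θ' ++ [v]) ?_ ?_ ?_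
      · rw [isWeaklyRegular_append_iff, isWeaklyRegular_singleton_iff]
        exact ⟨hθ', hvreg⟩
      · exact List.perm_append_singleton v θ'
      · intro r hr
        rcases List.mem_append.mp hr with hr | hr
        · exact hθ'm r hr
        · rw [List.mem_singleton.mp hr]
          exact hVm v hv
    rw [isWeaklyRegular_cons_iff] at hperm
    have hv0 : v ≠ 0 := by
      rintro rfl
      obtain ⟨x, hx⟩ := exists_ne (0 : M ⧸ (Ideal.ofList θ' • ⊤ : Submodule R M))
      exact hx (hvreg.right_eq_zero_of_smul (zero_smul _ _))
    obtain ⟨W, hW⟩ := Submodule.exists_isCompl (Submodule.span K {(⟨v, hv⟩ : V)})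
    have hsup : Submodule.span K {v} ⊔ W.map V.subtype = V := by
      have := congrArg (Submodule.map V.subtype) hW.sup_eq_top
      rw [Submodule.map_sup, Submodule.map_span, Submodule.map_top, Submodule.range_subtype] at this
      simpa using this
    have hWle : W.map V.subtype ≤ V := Submodule.map_subtype_le V W
    have hWfr : Module.finrank K (W.map V.subtype) ≤ n := by
      rw [Submodule.finrank_map_subtype_eq]
      have h1 := Submodule.finrank_add_eq_of_isCompl hW
      rw [finrank_span_singleton (by simpa using hv0)] at h1
      omega
    have := nontrivial_quotSMulTop_of_mem_maximalIdeal (L := M) (hVm v hv)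
    obtain ⟨η, hη, hspan⟩ := ih (QuotSMulTop v M) θ' hlen' hθ'm hperm.2 (W.map V.subtype)
      inferInstance hWfr (fun w hw => hVm w (hWle hw)) (by
        intro r hr
        obtain ⟨N, hN⟩ := hV r hr
        refine ⟨N, ?_⟩
        have hle : Ideal.span (V : Set R) ⊔ Module.annihilator R M ≤
            Ideal.span ((W.map V.subtype : Submodule K R) : Set R) ⊔
              Module.annihilator R (QuotSMulTop v M) := by
          refine sup_le (Ideal.span_le.mpr fun u hu => ?_) fun r hr => ?_
          · rw [SetLike.mem_coe] at hu
            rw [← hsup, Submodule.mem_sup] at hu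
            obtain ⟨y, hy, z, hz, rfl⟩ := hu
            obtain ⟨c, rfl⟩ := Submodule.mem_span_singleton.mp hy
            refine add_mem (Ideal.mem_sup_right ?_) (Ideal.mem_sup_left (Ideal.subset_span hz))
            rw [Algebra.smul_def]
            refine Ideal.mul_mem_left _ _ (Module.mem_annihilator.mpr fun m => ?_)
            obtain ⟨y, rfl⟩ := Submodule.mkQ_surjective _ m
            rw [← map_smul, ← LinearMap.mem_ker, Submodule.ker_mkQ]
            exact Submodule.smul_mem_pointwise_smul _ _ _ trivial
          · refine Ideal.mem_sup_right (Module.mem_annihilator.mpr fun m => ?_)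
            obtain ⟨y, rfl⟩ := Submodule.mkQ_surjective _ m
            rw [← map_smul, Module.mem_annihilator.mp hr, map_zero]
        exact hle hN)
    refine ⟨v :: η, IsWeaklyRegular.cons hperm.1 hη, ?_⟩
    have : {x | x ∈ v :: η} = insert v {x | x ∈ η} := by ext; simp
    rw [this, Submodule.span_insert, hspan, hsup]

open MvPolynomial in
theorem mem_of_algebraMap_mem {B : Type*} [CommRing B] (m I : Ideal B) [m.IsMaximal]
    (R : Type*) [CommRing R] [Algebra B R] [IsLocalization.AtPrime R m] (N : ℕ)
    (h : m ^ N ≤ I) (x : B)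
    (hx : algebraMap B R x ∈ I.map (algebraMap B R)) :
    x ∈ I := by
  rw [IsLocalization.algebraMap_mem_map_algebraMap_iff m.primeCompl] at hx
  obtain ⟨u, hu, hux⟩ := hx
  have hJ : I.colon {x} = ⊤ := by
    by_contra hne
    obtain ⟨P, hP, hle⟩ := Ideal.exists_le_maximal _ hne
    have h1 : m ^ N ≤ P := fun y hy => hle (by
      rw [Submodule.mem_colon_singleton]
      exact I.mul_mem_right _ (h hy))
    have h2 : m ≤ P := hP.isPrime.le_of_pow_le h1
    have h3 : m = P := (inferInstance : m.IsMaximal).eq_of_le hP.ne_top h2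
    refine hu ?_
    have : u ∈ P := hle (by rw [Submodule.mem_colon_singleton]; exact hux)
    rw [h3]; exact this
  have := (Ideal.eq_top_iff_one _).mp hJ
  simpa [Submodule.mem_colon_singleton] using this

open MvPolynomial in
theorem span_of_homogeneous (n : ℕ) (s : Fin n → MvPolynomial (Fin n) ℂ) (d : Fin n → ℕ)
    (hhom : ∀ i, (s i).IsHomogeneous (d i)) (h0 : ∀ i, MvPolynomial.eval 0 (s i) = 0)
    {κ : Type*} (a : κ → (Fin n →₀ ℕ))
    (hspan : ∀ f : MvPolynomial (Fin n) ℂ,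
      ∃ g ∈ Submodule.span ℂ (Set.range fun j => (monomial (a j) (1 : ℂ))),
        f - g ∈ Ideal.span (Set.range s)) :
    (⊤ : Submodule (Algebra.adjoin ℂ (Set.range s)) (MvPolynomial (Fin n) ℂ)) ≤
      Submodule.span _ (Set.range fun j => (monomial (a j) (1 : ℂ))) := by
  set W : Submodule (Algebra.adjoin ℂ (Set.range s)) (MvPolynomial (Fin n) ℂ) :=
    Submodule.span _ (Set.range fun j => (monomial (a j) (1 : ℂ))) with hW
  have hd : ∀ i, s i ≠ 0 → 0 < d i := by
    intro i hi
    by_contra hd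
    have hd : d i = 0 := by omega
    have h1 := (hhom i).totalDegree hi
    rw [hd, totalDegree_eq_zero_iff_eq_C] at h1
    have h2 := h0 i
    rw [h1, eval_C] at h2
    rw [h2, C_0] at h1
    exact hi h1
  have key : ∀ e : ℕ, ∀ f, homogeneousComponent e f ∈ W := by
    intro e
    induction e using Nat.strong_induction_on with
    | _ e ih =>
      let S : Submodule ℂ (MvPolynomial (Fin n) ℂ) :=
        (W.restrictScalars ℂ).comap (homogeneousComponent e)
      have hS1 : Submodule.span ℂ (Set.range fun j => (monomial (a j) (1 : ℂ))) ≤ S := by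
        rw [Submodule.span_le]
        rintro _ ⟨j, rfl⟩
        change homogeneousComponent e _ ∈ W
        rw [homogeneousComponent_of_mem (isHomogeneous_monomial (1 : ℂ) (rfl : (a j).degree = _))]
        split_ifs
        · exact Submodule.subset_span ⟨j, rfl⟩
        · exact zero_mem _
      have hS2 : ∀ f ∈ Ideal.span (Set.range s), f ∈ S := by
        intro f hf
        obtain ⟨g, rfl⟩ := (Ideal.mem_span_range_iff_exists_fun).mp hf
        refine sum_mem fun i _ => ?_
        rw [(g i).as_sum, Finset.sum_mul]
        refine sum_mem fun β _ => ?_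
        change homogeneousComponent e _ ∈ W
        by_cases hi : s i = 0
        · simp [hi]
        have hhm := (isHomogeneous_monomial (coeff β (g i)) (rfl : β.degree = _))
        rw [homogeneousComponent_of_mem (hhm.mul (hhom i))]
        split_ifs with he
        · have h1 := ih β.degree (by have := hd i hi; omega) (monomial β (coeff β (g i)))
          rw [homogeneousComponent_of_mem hhm, if_pos rfl] at h1
          rw [mul_comm]
          exact W.smul_mem ⟨s i, Algebra.subset_adjoin ⟨i, rfl⟩⟩ h1
        · exact zero_mem _
      intro f
      obtain ⟨g, hg, hfg⟩ := hspan f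
      have := S.add_mem (hS2 _ hfg) (hS1 hg)
      rw [sub_add_cancel] at this
      exact this
  intro f _
  rw [← sum_homogeneousComponent f]
  exact sum_mem fun e _ => key e f

open MvPolynomial in
theorem linInd_aux {B R : Type*} [CommRing B] [IsDomain B] [IsNoetherianRing B] [Algebra ℂ B]
    [CommRing R] [Algebra B R] [Algebra ℂ R] [IsScalarTower ℂ B R]
    (n : ℕ) (s : Fin n → B)
    (m : Ideal B) [hm : m.IsMaximal] [IsLocalization.AtPrime R m]
    (θ : List B) (hlen : θ.length = n) (hX : ∀ x ∈ θ, x ∈ m) (hθ0 : IsWeaklyRegular B θ)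
    (I : Ideal B) (hI : I = Ideal.span (Set.range s)) (hIm : I ≤ m) (N : ℕ)
    (hN : m ^ N ≤ I)
    {κ : Type*} [Finite κ] (b : κ → B)
    (hb : LinearIndependent ℂ (fun j => Ideal.Quotient.mk I (b j))) :
    LinearIndependent (Algebra.adjoin ℂ (Set.range s)) b := by
  have := Fintype.ofFinite κ
  have : IsLocalRing R := IsLocalization.AtPrime.isLocalRing R m
  have : IsNoetherianRing R := IsLocalization.isNoetherianRing m.primeCompl R inferInstance
  have hinj : Function.Injective (algebraMap B R) :=
    IsLocalization.injective R m.primeCompl_le_nonZeroDivisors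
  let φ : B →ₐ[ℂ] R := IsScalarTower.toAlgHom ℂ B R
  have hφ : ∀ x, φ x = algebraMap B R x := fun _ => rfl
  let V : Submodule ℂ R := Submodule.span ℂ (Set.range (φ ∘ s))
  have hmem : ∀ x ∈ m, algebraMap B R x ∈ IsLocalRing.maximalIdeal R := by
    intro x hx
    rw [← IsLocalization.AtPrime.map_eq_maximalIdeal m R]
    exact Ideal.mem_map_of_mem _ hx
  have hVspan : Ideal.span (V : Set R) = I.map (algebraMap B R) := by
    rw [hI, Ideal.map_span, ← Set.range_comp]
    exact Submodule.span_span_of_tower ℂ R _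
  have hθ : IsWeaklyRegular R (θ.map (algebraMap B R)) :=
    hθ0.of_isLocalization R m.primeCompl
  obtain ⟨η, hη, hηV⟩ := exists_weaklyRegular_list (K := ℂ) (R := R) n R _ (by simpa using hlen) (by
      intro r hr
      simp only [List.mem_map] at hr
      obtain ⟨i, hi, rfl⟩ := hr
      exact hmem _ (hX i hi)) hθ V (FiniteDimensional.span_of_finite ℂ (Set.finite_range _))
      ((finrank_range_le_card (R := ℂ) (φ ∘ s)).trans (by simp))
      (by
        intro v hv
        have h1 : v ∈ I.map (algebraMap B R) := hVspan ▸ Ideal.subset_span hv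
        rw [← IsLocalization.AtPrime.map_eq_maximalIdeal m R]
        exact Ideal.map_mono hIm h1)
      (by
        intro r hr
        refine ⟨N, Ideal.mem_sup_left ?_⟩
        rw [hVspan]
        refine Ideal.map_mono hN ?_
        rw [Ideal.map_pow, IsLocalization.AtPrime.map_eq_maximalIdeal m R]
        exact Ideal.pow_mem_pow hr N)
  have hofList : Ideal.ofList η = I.map (algebraMap B R) := by
    rw [← hVspan, ← hηV]
    exact (Submodule.span_span_of_tower ℂ R _).symm
  have hrange : Set.range η.get = {x | x ∈ η} := by
    ext x; simp [List.mem_iff_get]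
  have hA : ∀ x ∈ Algebra.adjoin ℂ (Set.range s), ∃ p : MvPolynomial (Fin η.length) ℂ,
      aeval η.get p = φ x := by
    intro x hx
    have h1 : φ x ∈ (Algebra.adjoin ℂ (Set.range s)).map φ := ⟨x, hx, rfl⟩
    rw [AlgHom.map_adjoin, ← Set.range_comp, ← Algebra.adjoin_span, show
      Submodule.span ℂ (Set.range (φ ∘ s)) = V from rfl, ← hηV, Algebra.adjoin_span, ← hrange,
      Algebra.adjoin_range_eq_range_aeval] at h1
    exact h1
  rw [Fintype.linearIndependent_iff]
  intro g hg
  choose p hp using fun j => hA (g j) (g j).2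
  have hp0 : p = 0 := by
    refine indep_of_weaklyRegular (K := ℂ) η.length R η.get (by rwa [List.ofFn_get])
      (fun j => algebraMap B R (b j)) ?_ p ?_
    · intro c hc
      rw [List.ofFn_get, hofList, smul_eq_mul, Ideal.mul_top] at hc
      have h1 : ∑ j, c j • b j ∈ I := by
        apply mem_of_algebraMap_mem m I R N hN
        convert hc using 1
        rw [map_sum]
        refine Finset.sum_congr rfl fun j _ => ?_
        rw [Algebra.smul_def, map_mul, ← IsScalarTower.algebraMap_apply]
        rfl
      funext j
      refine Fintype.linearIndependent_iff.mp hb c ?_ j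
      have h2 := Ideal.Quotient.eq_zero_iff_mem.mpr h1
      rw [map_sum] at h2
      exact h2
    · have h1 := congrArg (algebraMap B R) hg
      rw [map_sum, map_zero] at h1
      rw [← h1]
      refine Finset.sum_congr rfl fun j _ => ?_
      rw [hp, Subalgebra.smul_def, smul_eq_mul, smul_eq_mul, map_mul]
      rfl
  intro j
  have h1 := hp j
  rw [hp0, Pi.zero_apply, map_zero, hφ] at h1
  apply Subtype.ext
  apply hinj
  rw [← h1]
  simp

/-- If `s₁, …, sₙ` are homogeneous polynomials in `n` variables over `ℂ` whose only common
zero is the origin, then `ℂ[x₁,…,xₙ]` is a free module of finite rank over the subring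
`ℂ[s₁,…,sₙ]`. -/
theorem polynomialRing_free_finite_over_homogeneous_system
    (n : ℕ) (s : Fin n → MvPolynomial (Fin n) ℂ) (d : Fin n → ℕ)
    (hhom : ∀ i, (s i).IsHomogeneous (d i))
    (hzero : ∀ ξ : Fin n → ℂ, (∀ i, MvPolynomial.eval ξ (s i) = 0) ↔ ξ = 0) :
    Module.Free (Algebra.adjoin ℂ (Set.range s)) (MvPolynomial (Fin n) ℂ) ∧
    Module.Finite (Algebra.adjoin ℂ (Set.range s)) (MvPolynomial (Fin n) ℂ) := by
  have h0 : ∀ i, MvPolynomial.eval 0 (s i) = 0 := (hzero 0).mpr rfl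
  let m : Ideal (MvPolynomial (Fin n) ℂ) := RingHom.ker (MvPolynomial.eval (0 : Fin n → ℂ))
  have hmax : m.IsMaximal := RingHom.ker_isMaximal_of_surjective _
    (fun c => ⟨MvPolynomial.C c, by simp⟩)
  have hX : ∀ i, MvPolynomial.X i ∈ m := fun i => by simp [m, RingHom.mem_ker]
  set I : Ideal (MvPolynomial (Fin n) ℂ) := Ideal.span (Set.range s) with hI
  have hIm : I ≤ m := by
    rw [hI, Ideal.span_le]
    rintro _ ⟨i, rfl⟩
    exact h0 i
  have hrad : m ≤ I.radical := by
    rw [← MvPolynomial.vanishingIdeal_zeroLocus_eq_radical (K := ℂ)]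
    intro p hp x hx
    rw [hI, MvPolynomial.zeroLocus_span] at hx
    have hx0 : x = 0 := (hzero x).mp fun i => hx (s i) ⟨i, rfl⟩
    rw [hx0]
    exact hp
  obtain ⟨N, hN⟩ := Ideal.exists_pow_le_of_le_radical_of_fg hrad (IsNoetherian.noetherian m)
  obtain ⟨κ, a, ha, hsp, hli⟩ := exists_linearIndependent' ℂ
    (fun α : Fin n →₀ ℕ => Ideal.Quotient.mk I (MvPolynomial.monomial α (1 : ℂ)))
  have hdeg : ∀ j, (a j).degree ≤ N := by
    intro j
    by_contra hlt
    apply hli.ne_zero j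
    simp only [Function.comp_apply]
    rw [Ideal.Quotient.eq_zero_iff_mem]
    apply hN
    refine Ideal.pow_le_pow_right (le_of_lt (not_le.mp hlt)) ?_
    rw [MvPolynomial.monomial_eq, Finsupp.degree_eq_sum, ← Finset.prod_pow_eq_pow_sum]
    refine Ideal.mul_mem_left _ _ ?_
    rw [Finsupp.prod_fintype _ _ (by simp)]
    exact Ideal.prod_mem_prod fun i _ => Ideal.pow_mem_pow (hX i) _
  have hfin : Finite κ := by
    have : Finite {α : Fin n →₀ ℕ | α.degree ≤ N} := Finsupp.finite_of_degree_le N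
    exact Finite.of_injective (fun j => (⟨a j, hdeg j⟩ : {α : Fin n →₀ ℕ | α.degree ≤ N}))
      fun i j h => ha (congrArg Subtype.val h)
  have hind := linInd_aux (R := Localization.AtPrime m) n s m _ (by simp)
    (by simpa [List.mem_ofFn] using hX) (X_weaklyRegular n ℂ) I hI hIm N hN
    (fun j => MvPolynomial.monomial (a j) (1 : ℂ)) hli
  have hspan := span_of_homogeneous n s d hhom h0 a (by
    intro f
    let q : MvPolynomial (Fin n) ℂ →ₗ[ℂ] (MvPolynomial (Fin n) ℂ ⧸ I) :=
      (Ideal.Quotient.mkₐ ℂ I).toLinearMap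
    have h1 : q f ∈ Submodule.span ℂ (Set.range
        (q ∘ fun α : Fin n →₀ ℕ => MvPolynomial.monomial α (1 : ℂ))) := by
      rw [Set.range_comp, Submodule.span_image]
      refine Submodule.mem_map_of_mem ?_
      rw [← MvPolynomial.coe_basisMonomials, Module.Basis.span_eq]
      trivial
    have h2 : q f ∈ Submodule.span ℂ (Set.range
        (q ∘ fun j => MvPolynomial.monomial (a j) (1 : ℂ))) := by
      change q f ∈ Submodule.span ℂ (Set.range ((fun α : Fin n →₀ ℕ =>
        Ideal.Quotient.mk I (MvPolynomial.monomial α (1 : ℂ))) ∘ a))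
      rw [hsp]
      exact h1
    rw [Set.range_comp, Submodule.span_image] at h2
    obtain ⟨g, hg, hgf⟩ := h2
    exact ⟨g, hg, Ideal.Quotient.eq.mp hgf.symm⟩)
  let bas := Module.Basis.mk hind hspan
  exact ⟨Module.Free.of_basis bas, Module.Finite.of_basis bas⟩
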